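/- arXiv:1806.09741 — 3 statements merged into one kernel-verified Lean document; each statement's English description precedes it below -/
import Mathlib

section
/- Let R be a commutative ring, B a finitely generated commutative R-algebra, A an R-subalgebra of B, and p a prime ideal of R such that A and B have the same localization at p, in the precise sense that for every b ∈ B there exists s ∈ R with s ∉ p and s·b ∈ A. Then there exists f ∈ R with f ∉ p such that for every b ∈ B there exists n ∈ ℕ with f^n·b ∈ A (that is, the localizations A_f and B_f coincide). -/
/-- Lemma 4.1 (generatingalgebras): if an `R`-subalgebra `A` of a finitely
generated commutative `R`-algebra `B` agrees with `B` at a prime `p` (every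
`b ∈ B` is cleared into `A` by some `s ∉ p`), then it agrees on a principal
open neighborhood: there is `f ∉ p` with `A_f = B_f`. -/
theorem stmt0 (R : Type*) [CommRing R] (B : Type*) [CommRing B] [Algebra R B]
    [Algebra.FiniteType R B]
    (A : Subalgebra R B) (p : Ideal R) [p.IsPrime]
    (h : ∀ b : B, ∃ s : R, s ∉ p ∧ s • b ∈ A) :
    ∃ f : R, f ∉ p ∧ ∀ b : B, ∃ n : ℕ, f ^ n • b ∈ A := by
  classical
  obtain ⟨S, hS⟩ := (Algebra.FiniteType.out : (⊤ : Subalgebra R B).FG)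
  choose g hg hgA using h
  refine ⟨∏ b ∈ S, g b, ?_, ?_⟩
  · intro hmem
    obtain ⟨b, _, hb⟩ := (Ideal.IsPrime.prod_mem_iff).1 hmem
    exact hg b hb
  · intro b
    have hb : b ∈ Algebra.adjoin R (S : Set B) := by rw [hS]; trivial
    induction hb using Algebra.adjoin_induction with
    | mem x hx =>
      refine ⟨1, ?_⟩
      obtain ⟨c, hc⟩ := Finset.dvd_prod_of_mem g (Finset.mem_coe.1 hx)
      rw [pow_one, hc, mul_comm, mul_smul]
      exact A.smul_mem (hgA x) c
    | algebraMap r => exact ⟨0, A.smul_mem (A.algebraMap_mem r) _⟩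
    | add x y _ _ hx hy =>
      obtain ⟨m, hm⟩ := hx
      obtain ⟨n, hn⟩ := hy
      refine ⟨m + n, ?_⟩
      rw [smul_add]
      refine A.add_mem ?_ ?_
      · rw [pow_add, mul_comm, mul_smul]
        exact A.smul_mem hm _
      · rw [pow_add, mul_smul]
        exact A.smul_mem hn _
    | mul x y _ _ hx hy =>
      obtain ⟨m, hm⟩ := hx
      obtain ⟨n, hn⟩ := hy
      refine ⟨m + n, ?_⟩
      rw [pow_add, ← smul_mul_smul_comm]
      exact A.mul_mem hm hn
end

section
/- Let A be an integral domain with fraction field K, let d ≥ 1 and m ≥ 1 be natural numbers, and let a, a' : {1,…,m} → A be two tuples, each having at least one nonzero entry, such that for every multi-index (i_1, …, i_d) with entries in {1,…,m} one has a(i_1)⋯a(i_d) = a'(i_1)⋯a'(i_d) in A. Then there exists ξ ∈ K with ξ^d = 1 such that the image of a'(j) in K equals ξ times the image of a(j) in K, for every j ∈ {1,…,m}. -/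
open scoped BigOperators

/-- Proposition 5.1 (integral-domain case): two nonzero tuples
`a, a' : Fin m → A` whose degree-`d` products of entries all agree differ by a
`d`-th root of unity `ξ` in the fraction field of `A`. -/
theorem stmt2 (A : Type*) [CommRing A] [IsDomain A]
    (d m : ℕ) (hd : 1 ≤ d) (hm : 1 ≤ m)
    (a a' : Fin m → A)
    (ha : ∃ j, a j ≠ 0) (ha' : ∃ j, a' j ≠ 0)
    (h : ∀ i : Fin d → Fin m, ∏ k, a (i k) = ∏ k, a' (i k)) :
    ∃ ξ : FractionRing A, ξ ^ d = 1 ∧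
      ∀ j, algebraMap A (FractionRing A) (a' j) =
        ξ * algebraMap A (FractionRing A) (a j) := by
  obtain ⟨j0, hj0⟩ := ha
  obtain ⟨n, rfl⟩ : ∃ n, d = n + 1 := ⟨d - 1, by omega⟩
  have h1 : a j0 ^ (n + 1) = a' j0 ^ (n + 1) := by
    simpa using h (fun _ => j0)
  have h2 : ∀ j, a j * a j0 ^ n = a' j * a' j0 ^ n := by
    intro j
    simpa [Fin.prod_univ_succ] using h (Fin.cons j (fun _ => j0))
  have h3 : ∀ j, a' j * a j0 = a' j0 * a j := by
    intro j
    apply mul_right_cancel₀ (pow_ne_zero n hj0)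
    calc a' j * a j0 * a j0 ^ n = a' j * a j0 ^ (n + 1) := by ring
      _ = a' j0 * (a' j * a' j0 ^ n) := by rw [h1]; ring
      _ = a' j0 * a j * a j0 ^ n := by rw [← h2 j]; ring
  have hne : algebraMap A (FractionRing A) (a j0) ≠ 0 := by
    simpa using hj0
  refine ⟨algebraMap A (FractionRing A) (a' j0) / algebraMap A (FractionRing A) (a j0), ?_, ?_⟩
  · rw [div_pow, ← map_pow, ← map_pow, ← h1]
    apply div_self
    rw [map_pow]
    exact pow_ne_zero _ hne
  · intro j
    rw [div_mul_eq_mul_div, eq_div_iff hne, ← map_mul, ← map_mul, h3 j]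
end

section
/- Let A be an integral domain with fraction field K, let d ≥ 1 be a natural number, let M be a finitely generated A-module, and let τ, τ' : M → A be two nonzero A-linear maps such that for all elements m_1, …, m_d ∈ M one has τ(m_1)⋯τ(m_d) = τ'(m_1)⋯τ'(m_d) in A. Then there exists ξ ∈ K with ξ^d = 1 such that for every m ∈ M the image of τ'(m) in K equals ξ times the image of τ(m) in K. -/
open scoped BigOperators

/-- Corollary 5.2 (integral-domain case): two nonzero linear forms
`τ, τ' : M → A` on a finitely generated module whose degree-`d` symmetric
powers agree (all degree-`d` products of values coincide) differ by a `d`-th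
root of unity `ξ` in the fraction field of `A`. -/
theorem stmt3 (A : Type*) [CommRing A] [IsDomain A]
    (d : ℕ) (hd : 1 ≤ d)
    (M : Type*) [AddCommGroup M] [Module A M] [Module.Finite A M]
    (τ τ' : M →ₗ[A] A) (hτ : τ ≠ 0) (hτ' : τ' ≠ 0)
    (h : ∀ m : Fin d → M, ∏ k, τ (m k) = ∏ k, τ' (m k)) :
    ∃ ξ : FractionRing A, ξ ^ d = 1 ∧
      ∀ x : M, algebraMap A (FractionRing A) (τ' x) =
        ξ * algebraMap A (FractionRing A) (τ x) := by
  obtain ⟨m₀, hm₀⟩ : ∃ m, τ m ≠ 0 := by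
    by_contra hc
    push Not at hc
    exact hτ (LinearMap.ext hc)
  obtain ⟨n, rfl⟩ : ∃ n, d = n + 1 := ⟨d - 1, by omega⟩
  have h1 : τ m₀ ^ (n + 1) = τ' m₀ ^ (n + 1) := by
    simpa using h (fun _ => m₀)
  have h2 : ∀ x, τ x * τ m₀ ^ n = τ' x * τ' m₀ ^ n := by
    intro x
    simpa [Fin.prod_univ_succ] using h (Fin.cons x (fun _ => m₀))
  have hb : τ' m₀ ≠ 0 := by
    intro hb
    rw [hb, zero_pow (Nat.succ_ne_zero n)] at h1
    exact hm₀ (pow_eq_zero_iff (Nat.succ_ne_zero n) |>.1 h1)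
  have h3 : ∀ x, τ' x * τ m₀ = τ' m₀ * τ x := by
    intro x
    apply mul_right_cancel₀ (pow_ne_zero n hb)
    linear_combination (-τ m₀) * h2 x + τ x * h1
  have ha : algebraMap A (FractionRing A) (τ m₀) ≠ 0 := by
    simpa using hm₀
  refine ⟨algebraMap A (FractionRing A) (τ' m₀) / algebraMap A (FractionRing A) (τ m₀), ?_, ?_⟩
  · rw [div_pow, ← map_pow (algebraMap A (FractionRing A)), ← h1, map_pow]
    exact div_self (pow_ne_zero _ ha)
  · intro x
    rw [div_mul_eq_mul_div, eq_div_iff ha, ← map_mul, ← map_mul, h3]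
end
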